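/- Under the dichotomy hypotheses (c₁)–(c₃) of the Grobman–Hartman section (nonuniform (h,k,μ,ν)-dichotomy on ℤ with |a|, b > 1, h ∈ Δ₁, k ∈ Δ₂, and the nonlinear bound ‖f_m(x)‖ ≤ α̂ min{μ_{|m+1|}^{-ε}, ν_{|m+1|}^{-ε}}), the sequence h_m(m̄,ξ) = −∑_{τ=-∞}^{m-1} 𝒜(m,τ+1)P_{τ+1} f_τ(X_τ) + ∑_{τ=m}^{∞} 𝒜(m,τ+1)Q_{τ+1} f_τ(X_τ) is well-defined (both series converge absolutely) and satisfies ‖h_m(m̄,ξ)‖ ≤ K α̂ (ω₁ ζ_a + ω₂ ζ_{-b}) for all m ∈ ℤ, where ζ_l = ∑_{τ=1}^∞ τ^l. -/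

import Mathlib

open Filter

/-- A growth rate on `ℤ`. -/
def IsGrowthRate (u : ℤ → ℝ) : Prop :=
  StrictMono u ∧ u 0 = 1 ∧ Tendsto u atTop atTop ∧ Tendsto u atBot (nhds 0)

theorem IsGrowthRate.pos {u : ℤ → ℝ} (hu : IsGrowthRate u) (n : ℤ) : 0 < u n :=
  (hu.1.monotone.le_of_tendsto hu.2.2.2 (n - 1)).trans_lt (hu.1 (by omega))

/-- A weight `r ^ ε` in an operator bound cancels the weight `r ^ (-ε)` in a vector bound. -/
theorem norm_apply_le_of_rpow_weights {X : Type*} [NormedAddCommGroup X] [NormedSpace ℝ X]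
    {T : X →L[ℝ] X} {y : X} {C α r ε : ℝ} (hr : 0 < r)
    (hT : ‖T‖ ≤ C * r ^ ε) (hy : ‖y‖ ≤ α * r ^ (-ε)) : ‖T y‖ ≤ C * α := by
  have hcancel : r ^ ε * r ^ (-ε) = 1 := by
    rw [← Real.rpow_add hr, add_neg_cancel, Real.rpow_zero]
  calc ‖T y‖ ≤ (C * r ^ ε) * (α * r ^ (-ε)) :=
        T.le_of_opNorm_le_of_le hT hy
    _ = C * α * (r ^ ε * r ^ (-ε)) := by ring
    _ = C * α := by rw [hcancel, mul_one]

theorem stmt13 {X : Type*} [NormedAddCommGroup X] [NormedSpace ℝ X] [CompleteSpace X]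
    (𝓐 : ℤ → ℤ → X →L[ℝ] X)
    (hcoc : ∀ m n k : ℤ, (𝓐 m n).comp (𝓐 n k) = 𝓐 m k)
    (hid : ∀ n : ℤ, 𝓐 n n = ContinuousLinearMap.id ℝ X)
    (P : ℤ → X →L[ℝ] X)
    (hproj : ∀ n, (P n).comp (P n) = P n)
    (hcomm : ∀ m n, (P m).comp (𝓐 m n) = (𝓐 m n).comp (P n))
    (h k μ ν : ℤ → ℝ) (hh : IsGrowthRate h) (hk : IsGrowthRate k)
    (hμ : IsGrowthRate μ) (hν : IsGrowthRate ν)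
    (K a b ε : ℝ) (hK : 0 < K) (ha : a < -1) (hb : 1 < b) (hε : 0 ≤ ε)
    (hbound1 : ∀ m n, n ≤ m → ‖(𝓐 m n).comp (P n)‖ ≤ K * (h m / h n) ^ a * μ |n| ^ ε)
    (hbound2 : ∀ m n, m ≤ n →
      ‖(𝓐 m n).comp (ContinuousLinearMap.id ℝ X - P n)‖ ≤ K * (k n / k m) ^ (-b) * ν |n| ^ ε)
    (ω₁ ω₂ : ℕ) (hω₁ : 0 < ω₁) (hω₂ : 0 < ω₂)
    (hΔ₁ : ∀ m : ℤ, Summable (fun τ : ℕ => (h m / h (m - τ)) ^ a) ∧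
      (∑' τ : ℕ, (h m / h (m - τ)) ^ a) ≤ (ω₁ : ℝ) * ∑' τ : ℕ, ((τ : ℝ) + 1) ^ a)
    (hΔ₂ : ∀ m : ℤ, Summable (fun τ : ℕ => k (m + τ + 1) ^ (-b)) ∧
      k m ^ b * (∑' τ : ℕ, k (m + τ + 1) ^ (-b)) ≤ (ω₂ : ℝ) * ∑' τ : ℕ, ((τ : ℝ) + 1) ^ (-b))
    (f : ℤ → X → X) (α : ℝ) (hα : 0 < α)
    (hf : ∀ (m : ℤ) (x : X), ‖f m x‖ ≤ α * min (μ |m + 1| ^ (-ε)) (ν |m + 1| ^ (-ε)))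
    (Xseq : ℤ → X) :
    (∀ m : ℤ, Summable (fun τ : ℕ =>
        ‖(𝓐 m (m - τ)) (P (m - τ) (f (m - τ - 1) (Xseq (m - τ - 1))))‖)) ∧
      (∀ m : ℤ, Summable (fun τ : ℕ =>
        ‖(𝓐 m (m + τ + 1)) ((ContinuousLinearMap.id ℝ X - P (m + τ + 1))
          (f (m + τ) (Xseq (m + τ))))‖)) ∧
      ∀ m : ℤ,
        ‖(-∑' τ : ℕ, (𝓐 m (m - τ)) (P (m - τ) (f (m - τ - 1) (Xseq (m - τ - 1)))))
            + ∑' τ : ℕ, (𝓐 m (m + τ + 1)) ((ContinuousLinearMap.id ℝ X - P (m + τ + 1))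
                (f (m + τ) (Xseq (m + τ))))‖
          ≤ K * α * ((ω₁ : ℝ) * (∑' τ : ℕ, ((τ : ℝ) + 1) ^ a)
              + (ω₂ : ℝ) * (∑' τ : ℕ, ((τ : ℝ) + 1) ^ (-b))) := by
  have stable_le : ∀ (m : ℤ) (τ : ℕ),
      ‖(𝓐 m (m - τ)) (P (m - τ) (f (m - τ - 1) (Xseq (m - τ - 1))))‖
        ≤ K * α * (h m / h (m - τ)) ^ a := by
    intro m τ
    have hf' := (hf (m - τ - 1) (Xseq (m - τ - 1))).trans
      (mul_le_mul_of_nonneg_left (min_le_left _ _) hα.le)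
    rw [sub_add_cancel] at hf'
    have hle := norm_apply_le_of_rpow_weights (hμ.pos _)
      (hbound1 m (m - τ) (by omega)) hf'
    rw [mul_right_comm] at hle
    exact hle
  have unstable_le : ∀ (m : ℤ) (τ : ℕ),
      ‖(𝓐 m (m + τ + 1)) ((ContinuousLinearMap.id ℝ X - P (m + τ + 1))
          (f (m + τ) (Xseq (m + τ))))‖
        ≤ K * α * (k m ^ b * k (m + τ + 1) ^ (-b)) := by
    intro m τ
    have hf' := (hf (m + τ) (Xseq (m + τ))).trans
      (mul_le_mul_of_nonneg_left (min_le_right _ _) hα.le)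
    have hle := norm_apply_le_of_rpow_weights (hν.pos _)
      (hbound2 m (m + τ + 1) (by omega)) hf'
    rw [mul_right_comm, Real.div_rpow (hk.pos _).le (hk.pos _).le,
      Real.rpow_neg (hk.pos m).le, div_inv_eq_mul, mul_comm (k (m + τ + 1) ^ (-b))] at hle
    exact hle
  have stable_bound := fun m => (hΔ₁ m).1.mul_left (K * α)
  have unstable_bound := fun m => ((hΔ₂ m).1.mul_left (k m ^ b)).mul_left (K * α)
  refine ⟨fun m => (stable_bound m).of_nonneg_of_le (fun _ => norm_nonneg _) (stable_le m),
    fun m => (unstable_bound m).of_nonneg_of_le (fun _ => norm_nonneg _) (unstable_le m),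
    fun m => ?_⟩
  have hKα : 0 ≤ K * α := (mul_pos hK hα).le
  have hstable := tsum_of_norm_bounded (stable_bound m).hasSum (stable_le m)
  have hunstable := tsum_of_norm_bounded (unstable_bound m).hasSum (unstable_le m)
  rw [tsum_mul_left] at hstable
  rw [tsum_mul_left, tsum_mul_left] at hunstable
  rw [mul_add]
  refine (norm_add_le _ _).trans (add_le_add ?_ ?_)
  · rw [norm_neg]
    exact hstable.trans (mul_le_mul_of_nonneg_left (hΔ₁ m).2 hKα)
  · exact hunstable.trans (mul_le_mul_of_nonneg_left (hΔ₂ m).2 hKα)
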